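/- Let B = (B_t)_{t≥0} be a fractional Brownian motion of Hurst index H ∈ (0,1). Then with probability one, for all x ∈ ℝ simultaneously, Dim_H L_x ≤ 1 − H, where L_x = { t ≥ 0 : B_t = x }. -/

import Mathlib

open MeasureTheory ProbabilityTheory Set
open scoped ENNReal NNReal

noncomputable section

/-- The `n`-th dyadic block `[2^n, 2^(n+1))`, `n : ℕ`.  In the paper's numbering this is the
block `S_{n+1} = [2^{(n+1)-1}, 2^{n+1})`.  (The paper's blocks `S_{-1} = [0,1/2)` and
`S_0 = [1/2,1)` are degenerate: they contain no interval with distinct integer endpoints,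
and dropping finitely many blocks does not change the macroscopic Hausdorff dimension.) -/
def Sblock (n : ℕ) : Set ℝ := Set.Ico ((2 : ℝ) ^ n) ((2 : ℝ) ^ (n + 1))

/-- `c` is a proper cover of `E` restricted to the block `[2^n, 2^(n+1))`: a finite family of
nontrivial intervals `[p.1, p.2]` with integer endpoints `p.1 < p.2`, contained in the block,
whose union covers `E ∩ Sblock n`. -/
def IsProperCover (n : ℕ) (E : Set ℝ) (c : Finset (ℕ × ℕ)) : Prop :=
  (∀ p ∈ c, p.1 < p.2 ∧ (2 : ℝ) ^ n ≤ (p.1 : ℝ) ∧ (p.2 : ℝ) ≤ (2 : ℝ) ^ (n + 1)) ∧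
    E ∩ Sblock n ⊆ ⋃ p ∈ c, Set.Icc (p.1 : ℝ) (p.2 : ℝ)

/-- `ν_ρ^n(E) = inf { Σ_i (diam I_i / 2^(n+1))^ρ }` over proper covers of `E` restricted to
the block `[2^n, 2^(n+1))`.  (The normalizing factor `2^(n+1)` is the right endpoint of the
block, as in the paper.) -/
def nu (ρ : ℝ) (n : ℕ) (E : Set ℝ) : ℝ≥0∞ :=
  ⨅ (c : Finset (ℕ × ℕ)) (_ : IsProperCover n E c),
    ∑ p ∈ c, ENNReal.ofReal ((((p.2 : ℝ) - (p.1 : ℝ)) / 2 ^ (n + 1)) ^ ρ)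

/-- `ν̃_{ρ,ξ}^n(E)`, the variant of `ν_ρ^n(E)` with the extra logarithmic factor
`|log₂ (diam I_i / 2^(n+1))|^ξ` on each covering interval. -/
def nutilde (ρ ξ : ℝ) (n : ℕ) (E : Set ℝ) : ℝ≥0∞ :=
  ⨅ (c : Finset (ℕ × ℕ)) (_ : IsProperCover n E c),
    ∑ p ∈ c, ENNReal.ofReal ((((p.2 : ℝ) - (p.1 : ℝ)) / 2 ^ (n + 1)) ^ ρ *
      |Real.logb 2 (((p.2 : ℝ) - (p.1 : ℝ)) / 2 ^ (n + 1))| ^ ξ)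

/-- The macroscopic Hausdorff dimension
`Dim_H E = inf { ρ > 0 : Σ_n ν_ρ^n(E) < ∞ }`. -/
def macroDim (E : Set ℝ) : ℝ :=
  sInf {ρ : ℝ | 0 < ρ ∧ (∑' n : ℕ, nu ρ n E) ≠ ∞}

/-- `B` is a fractional Brownian motion of Hurst index `H` under the probability measure `P`:
a (jointly in finite-dimensional distributions) centered Gaussian process on `[0,∞)` with
continuous sample paths and covariance `E(B_s B_t) = (s^{2H} + t^{2H} - |s-t|^{2H})/2`. -/
structure IsFractionalBrownianMotion {Ω : Type*} [MeasurableSpace Ω]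
    (P : Measure Ω) (H : ℝ) (B : ℝ → Ω → ℝ) : Prop where
  measurable : ∀ t : ℝ, Measurable (B t)
  continuous : ∀ ω : Ω, ContinuousOn (fun t => B t ω) (Set.Ici 0)
  gaussian : ∀ (m : ℕ) (t : Fin m → ℝ) (c : Fin m → ℝ), (∀ i, 0 ≤ t i) →
    ∃ v : ℝ≥0, P.map (fun ω => ∑ i, c i * B (t i) ω) = gaussianReal 0 v
  covariance : ∀ s t : ℝ, 0 ≤ s → 0 ≤ t →
    ∫ ω, B s ω * B t ω ∂P = (s ^ (2 * H) + t ^ (2 * H) - |s - t| ^ (2 * H)) / 2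

/-- `L` is a local time for the process `B` under `P`: for each `t ≥ 0`, almost surely
`x ↦ L t x ω` is a density of the occupation measure `A ↦ Leb{s ∈ [0,t] : B_s ∈ A}`. -/
structure IsLocalTime {Ω : Type*} [MeasurableSpace Ω] (P : Measure Ω)
    (B : ℝ → Ω → ℝ) (L : ℝ → ℝ → Ω → ℝ) : Prop where
  measurable : ∀ t x : ℝ, Measurable (fun ω => L t x ω)
  nonneg : ∀ t x ω, 0 ≤ L t x ω
  density : ∀ t : ℝ, 0 ≤ t → ∀ᵐ ω ∂P, ∀ A : Set ℝ, MeasurableSet A →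
    volume {s : ℝ | s ∈ Set.Icc 0 t ∧ B s ω ∈ A} = ENNReal.ofReal (∫ x in A, L t x ω)

/-- The level set `L_x = {t ≥ 0 : B_t = x}` of the sample path `B · ω`. -/
def levelSet {Ω : Type*} (B : ℝ → Ω → ℝ) (x : ℝ) (ω : Ω) : Set ℝ :=
  {t : ℝ | 0 ≤ t ∧ B t ω = x}

/-- `Z_n^x = L^x(S_n) / 2^{n(1-H)} = (L^x_{2^n} - L^x_{2^{n-1}}) / 2^{n(1-H)}`, `n : ℕ`. -/
def Z {Ω : Type*} (H : ℝ) (L : ℝ → ℝ → Ω → ℝ) (n : ℕ) (x : ℝ) (ω : Ω) : ℝ :=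
  (L ((2 : ℝ) ^ n) x ω - L ((2 : ℝ) ^ n / 2) x ω) / (2 : ℝ) ^ ((n : ℝ) * (1 - H))

/-- `Z̃_n^a = inf_{x ∈ [-a,a]} Z_n^x`. -/
def Ztilde {Ω : Type*} (H : ℝ) (L : ℝ → ℝ → Ω → ℝ) (n : ℕ) (a : ℝ) (ω : Ω) : ℝ :=
  ⨅ x : Set.Icc (-a) a, Z H L n (x : ℝ) ω

/-- `F_∞^x = Σ_{n ≥ -1} Z_n^x ∈ [0,∞]`; the `n = -1` term is
`L^x(S_{-1}) / 2^{-(1-H)} = (L^x_{1/2} - L^x_0) · 2^{1-H}`. -/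
def Finf {Ω : Type*} (H : ℝ) (L : ℝ → ℝ → Ω → ℝ) (x : ℝ) (ω : Ω) : ℝ≥0∞ :=
  ENNReal.ofReal ((L (1 / 2) x ω - L 0 x ω) * (2 : ℝ) ^ (1 - H)) +
    ∑' n : ℕ, ENNReal.ofReal (Z H L n x ω)

/-- `F̃_∞^b = Σ_{n ≥ 1} Z̃_n^b ∈ [0,∞]`. -/
def Ftilde {Ω : Type*} (H : ℝ) (L : ℝ → ℝ → Ω → ℝ) (b : ℝ) (ω : Ω) : ℝ≥0∞ :=
  ∑' n : ℕ, ENNReal.ofReal (Ztilde H L (n + 1) b ω)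

/-- Chaining along dyadic points: a continuous function on `[0,1]` whose increments at dyadic scale
`2^{-j}` are at most `a j` stays within any bound of the partial sums of `a`. -/
lemma abs_sub_le_of_dyadic_increments {f : ℝ → ℝ} (hf : ContinuousOn f (Icc 0 1)) {a : ℕ → ℝ}
    {S : ℝ} (ha : ∀ j, 0 ≤ a j) (hS : ∀ J, ∑ j ∈ Finset.range J, a j ≤ S)
    (hinc : ∀ j i : ℕ, i < 2 ^ j → |f ((i + 1 : ℕ) / 2 ^ j) - f (i / 2 ^ j)| ≤ a j)
    {t : ℝ} (ht : t ∈ Icc (0 : ℝ) 1) : |f t - f 0| ≤ S := by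
  have hdy : ∀ j i : ℕ, i ≤ 2 ^ j →
      |f (i / 2 ^ j) - f 0| ≤ ∑ l ∈ Finset.range (j + 1), a l := by
    intro j
    induction j with
    | zero =>
      intro i hi
      have h0 := hinc 0 0 (by norm_num)
      have : i = 0 ∨ i = 1 := by simp at hi; omega
      rcases this with rfl | rfl
      · simpa using ha 0
      · simpa using h0
    | succ j ih =>
      intro i hi
      have hhalf : ∀ m : ℕ, ((2 * m : ℕ) : ℝ) / 2 ^ (j + 1) = m / 2 ^ j := by
        intro m
        rw [pow_succ', Nat.cast_mul, Nat.cast_ofNat, mul_div_mul_left _ _ two_ne_zero]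
      rw [Finset.sum_range_succ]
      rcases Nat.even_or_odd' i with ⟨m, rfl | rfl⟩
      · have := ih m (by rw [pow_succ] at hi; omega)
        rw [hhalf]
        linarith [ha (j + 1)]
      · have h1 := ih m (by rw [pow_succ] at hi; omega)
        have h2 := hinc (j + 1) (2 * m) (by omega)
        rw [hhalf] at h2
        have := abs_sub_le (f ((2 * m + 1 : ℕ) / 2 ^ (j + 1))) (f (m / 2 ^ j)) (f 0)
        linarith
  have hlim : Filter.Tendsto (fun j : ℕ => (⌊t * 2 ^ j⌋₊ : ℝ) / 2 ^ j) Filter.atTop (nhds t) :=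
    (tendsto_nat_floor_mul_div_atTop ht.1).comp
      (tendsto_pow_atTop_atTop_of_one_lt (one_lt_two : (1 : ℝ) < 2))
  have hfloor : ∀ j : ℕ, ⌊t * 2 ^ j⌋₊ ≤ 2 ^ j := by
    intro j
    rw [← Nat.cast_le (α := ℝ)]
    refine (Nat.floor_le (by have := ht.1; positivity)).trans ?_
    push_cast
    exact mul_le_of_le_one_left (by positivity) ht.2
  have hmem : ∀ j : ℕ, (⌊t * 2 ^ j⌋₊ : ℝ) / 2 ^ j ∈ Icc (0 : ℝ) 1 := by
    intro j
    refine ⟨by positivity, div_le_one_of_le₀ ?_ (by positivity)⟩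
    exact_mod_cast hfloor j
  have hcont : Filter.Tendsto (fun j : ℕ => |f ((⌊t * 2 ^ j⌋₊ : ℝ) / 2 ^ j) - f 0|) Filter.atTop
      (nhds |f t - f 0|) := by
    have := (hf t ht).tendsto.comp
      (tendsto_nhdsWithin_iff.2 ⟨hlim, Filter.Eventually.of_forall hmem⟩)
    exact (this.sub_const _).abs
  exact le_of_tendsto' hcont fun j => (hdy j _ (hfloor j)).trans (hS _)

section FractionalBrownianMotion

variable {Ω : Type*} [MeasurableSpace Ω] {P : Measure Ω}

section Gaussian

variable {X : Ω → ℝ} {v : ℝ≥0}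

lemma memLp_two_of_map_eq_gaussianReal (hX : Measurable X) (h : P.map X = gaussianReal 0 v) :
    MemLp X 2 P := by
  have := memLp_id_gaussianReal (μ := 0) (v := v) 2
  rw [← h] at this
  exact (memLp_map_measure_iff aestronglyMeasurable_id hX.aemeasurable).1 this

lemma integral_sq_of_map_eq_gaussianReal (hX : Measurable X) (h : P.map X = gaussianReal 0 v) :
    ∫ ω, X ω ^ 2 ∂P = v := by
  rw [← variance_id_gaussianReal (μ := 0) (v := v), variance_of_integral_eq_zero
    aemeasurable_id (by simp), ← h, integral_map hX.aemeasurable (by fun_prop)]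
  rfl

/-- Polynomial tail bound for a centered Gaussian variable. -/
lemma measure_abs_ge_le_of_map_eq_gaussianReal [IsProbabilityMeasure P] (hX : Measurable X)
    (h : P.map X = gaussianReal 0 v) (hv : v ≠ 0) {r : ℝ} (hr : 0 < r) (N : ℕ) :
    P {ω | r ≤ |X ω|} ≤ ENNReal.ofReal (2 * N.factorial * (2 * v / r ^ 2) ^ N) := by
  have hv' : (0 : ℝ) < v := by positivity
  have key : ∀ Y : Ω → ℝ, Measurable Y → P.map Y = gaussianReal 0 v →
      P.real {ω | r ≤ Y ω} ≤ N.factorial * (2 * v / r ^ 2) ^ N := by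
    intro Y hY hYv
    have hint : Integrable (fun ω => Real.exp (r / v * Y ω)) P := by
      have := integrable_exp_mul_gaussianReal (μ := 0) (v := v) (r / v)
      rw [← hYv] at this
      exact this.comp_measurable hY
    have h1 := measure_ge_le_exp_mul_mgf (μ := P) (X := Y) r (t := r / v) (by positivity) hint
    rw [mgf_gaussianReal hYv, ← Real.exp_add] at h1
    have h2 : -(r / v) * r + (0 * (r / v) + v * (r / v) ^ 2 / 2) = -(r ^ 2 / (2 * v)) := by
      field_simp
      ring
    rw [h2, Real.exp_neg] at h1
    refine h1.trans ?_
    have h3 := Real.pow_div_factorial_le_exp (r ^ 2 / (2 * v)) (by positivity) N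
    refine (inv_anti₀ (by positivity) h3).trans_eq ?_
    rw [inv_div, div_eq_mul_inv, ← inv_pow, inv_div]
  have hneg : P.map (fun ω => -X ω) = gaussianReal 0 v := by
    have : P.map (fun ω => -X ω) = (P.map X).map (fun x => -x) := by
      rw [Measure.map_map measurable_neg hX]; rfl
    rw [this, h, gaussianReal_map_neg, neg_zero]
  have hsub : {ω | r ≤ |X ω|} ⊆ {ω | r ≤ X ω} ∪ {ω | r ≤ -X ω} :=
    fun ω (hω : r ≤ |X ω|) => le_abs.1 hω
  rw [← ofReal_measureReal]
  refine ENNReal.ofReal_le_ofReal ?_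
  calc P.real {ω | r ≤ |X ω|} ≤ P.real {ω | r ≤ X ω} + P.real {ω | r ≤ -X ω} :=
        (measureReal_mono hsub).trans (measureReal_union_le _ _)
    _ ≤ N.factorial * (2 * v / r ^ 2) ^ N + N.factorial * (2 * v / r ^ 2) ^ N :=
        add_le_add (key X hX h) (key _ hX.neg hneg)
    _ = _ := by ring

/-- Small ball estimate for a centered Gaussian variable. -/
lemma measure_abs_le_le_of_map_eq_gaussianReal (hX : Measurable X)
    (h : P.map X = gaussianReal 0 v) (hv : v ≠ 0) (r : ℝ) :
    P {ω | |X ω| ≤ r} ≤ ENNReal.ofReal (r / Real.sqrt v) := by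
  have hpre : {ω | |X ω| ≤ r} = X ⁻¹' Icc (-r) r := by
    ext ω
    simp [abs_le]
  have hv' : (0 : ℝ) < v := by positivity
  have hpdf : ∀ x, gaussianPDF 0 v x ≤ ENNReal.ofReal (2 * Real.sqrt v)⁻¹ := by
    intro x
    refine ENNReal.ofReal_le_ofReal ?_
    rw [gaussianPDFReal]
    have h1 : Real.exp (-(x - 0) ^ 2 / (2 * v)) ≤ 1 := by
      rw [Real.exp_le_one_iff, neg_div]
      have : 0 ≤ (x - 0) ^ 2 / (2 * (v : ℝ)) := by positivity
      linarith
    have h2 : 2 * Real.sqrt v ≤ Real.sqrt (2 * Real.pi * v) := by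
      rw [show (2 : ℝ) * Real.sqrt v = Real.sqrt (2 ^ 2 * v) by
        rw [Real.sqrt_mul (by positivity), Real.sqrt_sq (by norm_num)]]
      refine Real.sqrt_le_sqrt ?_
      nlinarith [Real.pi_gt_three]
    calc _ ≤ (Real.sqrt (2 * Real.pi * v))⁻¹ * 1 := by gcongr
      _ ≤ _ := by
        rw [mul_one]
        exact inv_anti₀ (by positivity) h2
  rw [hpre, ← Measure.map_apply hX measurableSet_Icc, h, gaussianReal_apply _ hv]
  calc ∫⁻ x in Icc (-r) r, gaussianPDF 0 v x
      ≤ ∫⁻ _ in Icc (-r) r, ENNReal.ofReal (2 * Real.sqrt v)⁻¹ := lintegral_mono fun x => hpdf x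
    _ = ENNReal.ofReal (r / Real.sqrt v) := by
      rw [setLIntegral_const, Real.volume_Icc, ← ENNReal.ofReal_mul (by positivity)]
      congr 1
      field_simp
      ring

end Gaussian

namespace IsFractionalBrownianMotion

variable {H : ℝ} {B : ℝ → Ω → ℝ}

lemma map_eq (hH : 0 < H) (hB : IsFractionalBrownianMotion P H B) {t : ℝ} (ht : 0 ≤ t) :
    P.map (B t) = gaussianReal 0 (t ^ (2 * H)).toNNReal := by
  obtain ⟨v, hv⟩ := hB.gaussian 1 (fun _ => t) (fun _ => 1) fun _ => ht
  simp only [Finset.univ_unique, one_mul, Finset.sum_const, Finset.card_singleton, one_smul] at hv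
  have h1 := integral_sq_of_map_eq_gaussianReal (hB.measurable t) hv
  have h2 := hB.covariance t t ht ht
  rw [sub_self, abs_zero, Real.zero_rpow (by positivity), sub_zero, add_self_div_two] at h2
  simp only [pow_two, h2] at h1
  rw [h1, Real.toNNReal_coe]
  exact hv

lemma map_sub_eq (hH : 0 < H) (hB : IsFractionalBrownianMotion P H B) {s t : ℝ} (hs : 0 ≤ s)
    (ht : 0 ≤ t) :
    P.map (fun ω => B t ω - B s ω) = gaussianReal 0 (|t - s| ^ (2 * H)).toNNReal := by
  obtain ⟨v, hv⟩ := hB.gaussian 2 ![t, s] ![1, -1] fun i => by fin_cases i <;> simpa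
  simp only [Fin.sum_univ_two, Matrix.cons_val_zero, Matrix.cons_val_one, one_mul, neg_mul,
    ← sub_eq_add_neg] at hv
  have h1 := integral_sq_of_map_eq_gaussianReal ((hB.measurable t).sub (hB.measurable s)) hv
  have hLt := memLp_two_of_map_eq_gaussianReal (hB.measurable t) (hB.map_eq hH ht)
  have hLs := memLp_two_of_map_eq_gaussianReal (hB.measurable s) (hB.map_eq hH hs)
  have hint : ∀ {X Y : Ω → ℝ}, MemLp X 2 P → MemLp Y 2 P → Integrable (fun ω => X ω * Y ω) P :=
    fun hX hY => hX.integrable_mul hY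
  have h2 : ∫ ω, (B t ω - B s ω) ^ 2 ∂P = |t - s| ^ (2 * H) := by
    have hexp : ∀ ω, (B t ω - B s ω) ^ 2 = B t ω * B t ω - 2 * (B t ω * B s ω) + B s ω * B s ω :=
      fun ω => by ring
    simp_rw [hexp]
    have hsub : Integrable (fun ω => B t ω * B t ω - 2 * (B t ω * B s ω)) P :=
      (hint hLt hLt).sub ((hint hLt hLs).const_mul 2)
    rw [integral_add hsub (hint hLs hLs),
      integral_sub (hint hLt hLt) ((hint hLt hLs).const_mul 2), integral_const_mul,
      hB.covariance t t ht ht, hB.covariance t s ht hs, hB.covariance s s hs hs, sub_self,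
      sub_self, abs_zero, Real.zero_rpow (by positivity)]
    ring
  have h3 : (v : ℝ) = |t - s| ^ (2 * H) := h1.symm.trans h2
  rw [← h3, Real.toNNReal_coe]
  exact hv

/-- The oscillation of a fractional Brownian motion over unit intervals has polynomial tails of
every order, uniformly in the interval. -/
lemma exists_measure_oscillation_le [IsProbabilityMeasure P] (hH : 0 < H)
    (hB : IsFractionalBrownianMotion P H B) {N : ℕ} (hN : 2 ≤ H * N) :
    ∃ C : ℝ, 0 ≤ C ∧ ∀ s : ℝ, 0 ≤ s → ∀ r : ℝ, 0 < r →
      P {ω | ∃ t ∈ Icc (0 : ℝ) 1, r < |B (s + t) ω - B s ω|} ≤ ENNReal.ofReal (C / r ^ (2 * N)) := by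
  set q : ℝ := 2 ^ (-(H / 2)) with hq
  have hq0 : 0 < q := by positivity
  have hq1 : q < 1 := Real.rpow_lt_one_of_one_lt_of_neg one_lt_two (by linarith)
  have hqN : 2 * q ^ (2 * N) ≤ 1 / 2 := by
    have h1 : q ^ (2 * N) = (2 : ℝ) ^ (-(H * N)) := by
      rw [hq, ← Real.rpow_natCast, ← Real.rpow_mul (by norm_num)]
      congr 1
      push_cast
      ring
    have h2 : (2 : ℝ) ^ (-(H * N)) ≤ (2 : ℝ) ^ (-2 : ℝ) :=
      Real.rpow_le_rpow_of_exponent_le one_le_two (by linarith)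
    have h3 : (2 : ℝ) ^ (-2 : ℝ) = 1 / 4 := by
      rw [Real.rpow_neg (by norm_num)]
      norm_num
    rw [h1]
    linarith [h2.trans_eq h3]
  have hc : 0 < 1 - q := by linarith
  refine ⟨2 * (2 * N.factorial * (2 / (1 - q) ^ 2) ^ N), by positivity, fun s hs r hr => ?_⟩
  set D : ℝ := 2 * N.factorial * (2 / (1 - q) ^ 2) ^ N with hD
  have hD0 : 0 ≤ D := by positivity
  let a : ℕ → ℝ := fun j => r * (1 - q) * q ^ j
  have ha : ∀ j, 0 < a j := fun j => by positivity
  have hsum : ∀ J, ∑ j ∈ Finset.range J, a j ≤ r := by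
    intro J
    rw [← Finset.mul_sum, mul_assoc, mul_neg_geom_sum]
    have : 0 < q ^ J := by positivity
    nlinarith
  let E : ℕ → ℕ → Set Ω := fun j i =>
    {ω | a j ≤ |B (s + (i + 1 : ℕ) / 2 ^ j) ω - B (s + i / 2 ^ j) ω|}
  have hsub : {ω | ∃ t ∈ Icc (0 : ℝ) 1, r < |B (s + t) ω - B s ω|} ⊆
      ⋃ j, ⋃ i ∈ Finset.range (2 ^ j), E j i := by
    rintro ω ⟨t, ht, hlt⟩
    by_contra hcon
    simp only [mem_iUnion, Finset.mem_range, not_exists] at hcon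
    have hcont : ContinuousOn (fun u => B (s + u) ω) (Icc 0 1) :=
      (hB.continuous ω).comp (by fun_prop) fun u hu => add_nonneg hs hu.1
    have := abs_sub_le_of_dyadic_increments hcont (fun j => (ha j).le) hsum
      (fun j i hi => (not_le.1 (hcon j i hi)).le) ht
    rw [add_zero] at this
    exact absurd hlt (not_lt.2 this)
  have hE : ∀ j i, P (E j i) ≤ ENNReal.ofReal (D / r ^ (2 * N) * (q ^ (2 * N)) ^ j) := by
    intro j i
    have hmap := hB.map_sub_eq hH (s := s + i / 2 ^ j) (t := s + (i + 1 : ℕ) / 2 ^ j)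
      (by positivity) (by positivity)
    have hdiff : |s + ((i + 1 : ℕ) : ℝ) / 2 ^ j - (s + i / 2 ^ j)| ^ (2 * H) = (q ^ j) ^ 4 := by
      have : s + ((i + 1 : ℕ) : ℝ) / 2 ^ j - (s + i / 2 ^ j) = (2 : ℝ) ^ (-(j : ℝ)) := by
        rw [Real.rpow_neg (by norm_num), Real.rpow_natCast]
        push_cast
        ring
      rw [this, abs_of_pos (by positivity), ← Real.rpow_mul (by norm_num), hq, ← pow_mul,
        ← Real.rpow_natCast, ← Real.rpow_mul (by norm_num)]
      congr 1
      push_cast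
      ring
    rw [hdiff] at hmap
    have hv : ((q ^ j) ^ 4).toNNReal ≠ 0 := by
      rw [Ne, Real.toNNReal_eq_zero, not_le]
      positivity
    refine (measure_abs_ge_le_of_map_eq_gaussianReal
      ((hB.measurable _).sub (hB.measurable _)) hmap hv (ha j) N).trans
      (ENNReal.ofReal_le_ofReal (le_of_eq ?_))
    rw [Real.coe_toNNReal _ (by positivity), hD]
    have : 2 * (q ^ j) ^ 4 / a j ^ 2 = 2 / (1 - q) ^ 2 * (q ^ j) ^ 2 / r ^ 2 := by
      simp only [a]
      field_simp
    rw [this, div_pow, mul_pow]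
    ring
  calc P {ω | ∃ t ∈ Icc (0 : ℝ) 1, r < |B (s + t) ω - B s ω|}
      ≤ P (⋃ j, ⋃ i ∈ Finset.range (2 ^ j), E j i) := measure_mono hsub
    _ ≤ ∑' j, P (⋃ i ∈ Finset.range (2 ^ j), E j i) := measure_iUnion_le _
    _ ≤ ∑' j : ℕ, ENNReal.ofReal (D / r ^ (2 * N) * (1 / 2) ^ j) := by
      refine ENNReal.tsum_le_tsum fun j => (measure_biUnion_finset_le _ _).trans ?_
      refine (Finset.sum_le_sum fun i _ => hE j i).trans ?_
      rw [Finset.sum_const, Finset.card_range, nsmul_eq_mul,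
        ← ENNReal.ofReal_natCast, ← ENNReal.ofReal_mul (by positivity)]
      refine ENNReal.ofReal_le_ofReal ?_
      push_cast
      calc (2 : ℝ) ^ j * (D / r ^ (2 * N) * (q ^ (2 * N)) ^ j)
          = D / r ^ (2 * N) * (2 * q ^ (2 * N)) ^ j := by rw [mul_pow]; ring
        _ ≤ _ := by gcongr
    _ = ENNReal.ofReal (2 * D / r ^ (2 * N)) := by
      rw [← ENNReal.ofReal_tsum_of_nonneg (fun j => by positivity)
        (summable_geometric_two.mul_left _), tsum_mul_left, tsum_geometric_two]
      congr 1
      ring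

/-- The probability that a fractional Brownian motion visits `[-A, A]` during `[k, k + 1]` is
`O(k^{ε - H})`. -/
lemma exists_measure_visit_le [IsProbabilityMeasure P] (hH : 0 < H)
    (hB : IsFractionalBrownianMotion P H B) {A ε : ℝ} (hA : 0 ≤ A) (hε : 0 < ε) :
    ∃ C : ℝ, 0 ≤ C ∧ ∀ k : ℕ, 1 ≤ k →
      P {ω | ∃ t ∈ Icc (0 : ℝ) 1, |B (k + t) ω| ≤ A} ≤ ENNReal.ofReal (C * (k : ℝ) ^ (ε - H)) := by
  obtain ⟨N, hN⟩ := exists_nat_ge (max (2 / H) (H / (2 * ε)))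
  have hN1 : 2 ≤ H * N := by
    have := (le_max_left _ _).trans hN
    rwa [div_le_iff₀ hH, mul_comm] at this
  have hN2 : H ≤ 2 * ε * N := by
    have := (le_max_right _ _).trans hN
    rwa [div_le_iff₀ (by positivity), mul_comm] at this
  obtain ⟨C, hC, hosc⟩ := hB.exists_measure_oscillation_le hH hN1
  refine ⟨A + 1 + C, by positivity, fun k hk => ?_⟩
  have hk1 : (1 : ℝ) ≤ k := by exact_mod_cast hk
  have hk0 : (0 : ℝ) < k := by linarith
  have hkε : 1 ≤ (k : ℝ) ^ ε := Real.one_le_rpow hk1 hε.le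
  have hsub : {ω | ∃ t ∈ Icc (0 : ℝ) 1, |B (k + t) ω| ≤ A} ⊆
      {ω | |B k ω| ≤ (A + 1) * (k : ℝ) ^ ε} ∪
        {ω | ∃ t ∈ Icc (0 : ℝ) 1, (k : ℝ) ^ ε < |B (k + t) ω - B k ω|} := by
    rintro ω ⟨t, ht, hle⟩
    by_cases h : (k : ℝ) ^ ε < |B (k + t) ω - B k ω|
    · exact Or.inr ⟨t, ht, h⟩
    · left
      have h1 : |B k ω| - |B (k + t) ω| ≤ |B k ω - B (k + t) ω| := abs_sub_abs_le_abs_sub _ _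
      rw [abs_sub_comm] at h1
      show |B k ω| ≤ _
      nlinarith
  have hsmall : P {ω | |B k ω| ≤ (A + 1) * (k : ℝ) ^ ε} ≤
      ENNReal.ofReal ((A + 1) * (k : ℝ) ^ (ε - H)) := by
    have hv : ((k : ℝ) ^ (2 * H)).toNNReal ≠ 0 := by
      rw [Ne, Real.toNNReal_eq_zero, not_le]
      positivity
    refine (measure_abs_le_le_of_map_eq_gaussianReal (hB.measurable k) (hB.map_eq hH hk0.le) hv
      _).trans_eq ?_
    rw [Real.coe_toNNReal _ (by positivity), mul_comm 2 H, Real.rpow_mul hk0.le, Real.rpow_two,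
      Real.sqrt_sq (by positivity), Real.rpow_sub hk0, mul_div_assoc]
  have hlarge : P {ω | ∃ t ∈ Icc (0 : ℝ) 1, (k : ℝ) ^ ε < |B (k + t) ω - B k ω|} ≤
      ENNReal.ofReal (C * (k : ℝ) ^ (ε - H)) := by
    refine (hosc k hk0.le _ (by positivity)).trans (ENNReal.ofReal_le_ofReal ?_)
    rw [← Real.rpow_natCast, ← Real.rpow_mul hk0.le, div_eq_mul_inv, ← Real.rpow_neg hk0.le]
    refine mul_le_mul_of_nonneg_left (Real.rpow_le_rpow_of_exponent_le hk1 ?_) hC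
    push_cast
    linarith
  calc _ ≤ _ := (measure_mono hsub).trans (measure_union_le _ _)
    _ ≤ _ := add_le_add hsmall hlarge
    _ = _ := by
      rw [← ENNReal.ofReal_add (by positivity) (by positivity), ← add_mul]

/-- Almost surely, the times `k` for which `[k, k + 1]` contains a visit to `[-A, A]` have a
summable `ρ`-weight as soon as `ρ > 1 - H`. -/
lemma ae_tsum_visit_lt_top [IsProbabilityMeasure P] (hH : 0 < H)
    (hB : IsFractionalBrownianMotion P H B) {A ρ : ℝ} (hA : 0 ≤ A) (hρ : 1 - H < ρ) :
    ∀ᵐ ω ∂P, ∑' k : ℕ, {k : ℕ | 1 ≤ k ∧ ∃ t ∈ Icc (0 : ℝ) 1, |B (k + t) ω| ≤ A}.indicator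
      (fun k : ℕ => ENNReal.ofReal ((k : ℝ) ^ (-ρ))) k < ∞ := by
  set ε : ℝ := (ρ - (1 - H)) / 2 with hε
  obtain ⟨C, hC, hvisit⟩ := hB.exists_measure_visit_le hH hA (ε := ε) (by linarith)
  let E : ℕ → Set Ω := fun k => {ω | 1 ≤ k ∧ ∃ t ∈ Icc (0 : ℝ) 1, |B (k + t) ω| ≤ A}
  let F : ℕ → Ω → ℝ≥0∞ := fun k =>
    (toMeasurable P (E k)).indicator fun _ => ENNReal.ofReal ((k : ℝ) ^ (-ρ))
  have hF : ∀ k, Measurable (F k) := fun k =>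
    measurable_const.indicator (measurableSet_toMeasurable _ _)
  have hFint : ∀ k, ∫⁻ ω, F k ω ∂P ≤ ENNReal.ofReal (C * (k : ℝ) ^ (ε - H - ρ)) := by
    intro k
    rw [lintegral_indicator_const (measurableSet_toMeasurable _ _), measure_toMeasurable]
    rcases Nat.eq_zero_or_pos k with rfl | hk
    · simp [E]
    · have hk0 : (0 : ℝ) < k := by exact_mod_cast hk
      have : P (E k) ≤ ENNReal.ofReal (C * (k : ℝ) ^ (ε - H)) :=
        (measure_mono fun ω hω => hω.2).trans (hvisit k hk)
      calc _ ≤ ENNReal.ofReal ((k : ℝ) ^ (-ρ)) * ENNReal.ofReal (C * (k : ℝ) ^ (ε - H)) := by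
            gcongr
        _ = _ := by
            rw [← ENNReal.ofReal_mul (by positivity), sub_eq_add_neg (ε - H), Real.rpow_add hk0]
            congr 1
            ring
  have hsum : Summable fun k : ℕ => C * (k : ℝ) ^ (ε - H - ρ) :=
    (Real.summable_nat_rpow.2 (by linarith)).mul_left C
  have hfin : ∫⁻ ω, ∑' k, F k ω ∂P ≠ ∞ := by
    rw [lintegral_tsum fun k => (hF k).aemeasurable]
    exact ne_top_of_le_ne_top hsum.tsum_ofReal_ne_top (ENNReal.tsum_le_tsum hFint)
  filter_upwards [ae_lt_top (Measurable.tsum fun k => hF k) hfin] with ω hω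
  refine lt_of_le_of_lt (ENNReal.tsum_le_tsum fun k => ?_) hω
  by_cases hk : ω ∈ E k
  · have h1 : F k ω = ENNReal.ofReal ((k : ℝ) ^ (-ρ)) :=
      indicator_of_mem (subset_toMeasurable P _ hk) _
    rw [h1]
    exact indicator_le_self _ _ _
  · rw [indicator_of_notMem]
    · exact zero_le
    · exact hk

end IsFractionalBrownianMotion

end FractionalBrownianMotion

/-- Covering by unit intervals bounds `ν_ρ^n(E)` by the `ρ`-weight of the integers `k` of the block
such that `[k, k + 1]` meets `E`. -/
lemma nu_le_sum_indicator {ρ : ℝ} (hρ : 0 ≤ ρ) (n : ℕ) {E : Set ℝ} {K : Set ℕ}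
    (hK : ∀ k : ℕ, 1 ≤ k → (∃ t ∈ Icc (0 : ℝ) 1, (k : ℝ) + t ∈ E) → k ∈ K) :
    nu ρ n E ≤ ∑ k ∈ Finset.Ico (2 ^ n) (2 ^ (n + 1)),
      K.indicator (fun k : ℕ => ENNReal.ofReal ((k : ℝ) ^ (-ρ))) k := by
  classical
  let φ : ℕ ↪ ℕ × ℕ := ⟨fun k => (k, k + 1), fun a b h => (Prod.ext_iff.1 h).1⟩
  let s : Finset ℕ := (Finset.Ico (2 ^ n) (2 ^ (n + 1))).filter (· ∈ K)
  have hcover : IsProperCover n E (s.map φ) := by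
    constructor
    · intro p hp
      obtain ⟨k, hk, rfl⟩ := Finset.mem_map.1 hp
      obtain ⟨hk1, hk2⟩ := Finset.mem_Ico.1 (Finset.mem_filter.1 hk).1
      refine ⟨Nat.lt_succ_self k, ?_, ?_⟩
      · exact_mod_cast hk1
      · exact_mod_cast Nat.succ_le_of_lt hk2
    · rintro t ⟨htE, ht1, ht2⟩
      have ht0 : 0 ≤ t := le_trans (by positivity) ht1
      have hfl := Nat.floor_le ht0
      have hlt := Nat.lt_floor_add_one t
      have hle : 2 ^ n ≤ ⌊t⌋₊ := Nat.le_floor (by exact_mod_cast ht1)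
      have hkK : ⌊t⌋₊ ∈ K :=
        hK _ (Nat.one_le_two_pow.trans hle) ⟨t - ⌊t⌋₊, ⟨by linarith, by linarith⟩, by simpa⟩
      have hks : ⌊t⌋₊ ∈ s := by
        refine Finset.mem_filter.2 ⟨Finset.mem_Ico.2 ⟨hle, ?_⟩, hkK⟩
        exact (Nat.floor_lt ht0).2 (by exact_mod_cast ht2)
      refine mem_iUnion₂.2 ⟨φ ⌊t⌋₊, Finset.mem_map_of_mem φ hks, hfl, ?_⟩
      exact hlt.le.trans_eq (Nat.cast_succ _).symm
  refine (iInf₂_le _ hcover).trans ?_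
  rw [Finset.sum_map, Finset.sum_filter]
  refine Finset.sum_le_sum fun k hk => ?_
  obtain ⟨hk1, hk2⟩ := Finset.mem_Ico.1 hk
  have hk0 : (0 : ℝ) < k := by exact_mod_cast (Nat.two_pow_pos n).trans_le hk1
  rw [indicator_apply]
  split_ifs
  · refine ENNReal.ofReal_le_ofReal ?_
    have hdiam : ((φ k).2 : ℝ) - (φ k).1 = 1 := by
      change ((k + 1 : ℕ) : ℝ) - (k : ℝ) = 1
      push_cast
      ring
    rw [hdiam, one_div, Real.rpow_neg hk0.le, ← Real.inv_rpow hk0.le]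
    refine Real.rpow_le_rpow (by positivity) (inv_anti₀ hk0 ?_) hρ
    exact_mod_cast hk2.le
  · exact le_rfl

/-- Summing over dyadic blocks counts every integer at most once. -/
lemma tsum_sum_Ico_two_pow_le (g : ℕ → ℝ≥0∞) :
    ∑' n : ℕ, ∑ k ∈ Finset.Ico (2 ^ n) (2 ^ (n + 1)), g k ≤ ∑' k, g k := by
  have hinj : Function.Injective
      fun p : Σ n : ℕ, Finset.Ico (2 ^ n) (2 ^ (n + 1)) => (p.2 : ℕ) := by
    rintro ⟨n, k, hk⟩ ⟨m, l, hl⟩ (h : k = l)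
    subst h
    have hlog : ∀ {i : ℕ}, k ∈ Finset.Ico (2 ^ i) (2 ^ (i + 1)) → Nat.log 2 k = i := fun hi =>
      Nat.log_eq_of_pow_le_of_lt_pow (Finset.mem_Ico.1 hi).1 (Finset.mem_Ico.1 hi).2
    obtain rfl : n = m := (hlog hk).symm.trans (hlog hl)
    rfl
  calc _ = ∑' p : Σ n : ℕ, Finset.Ico (2 ^ n) (2 ^ (n + 1)), g p.2 := by
        rw [ENNReal.tsum_sigma']
        exact tsum_congr fun n => (Finset.tsum_subtype _ g).symm
    _ ≤ _ := ENNReal.tsum_comp_le_tsum_of_injective hinj g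

/-- upper bound.  If `B` is a fractional Brownian motion of Hurst index
`H ∈ (0,1)`, then with probability one, simultaneously for all `x ∈ ℝ`,
`Dim_H L_x ≤ 1 - H` where `L_x = {t ≥ 0 : B_t = x}`. -/
theorem macroDim_levelSet_le {Ω : Type*} [MeasurableSpace Ω]
    (P : Measure Ω) [IsProbabilityMeasure P] (H : ℝ) (hH : H ∈ Set.Ioo (0 : ℝ) 1)
    (B : ℝ → Ω → ℝ) (hB : IsFractionalBrownianMotion P H B) :
    P {ω | ∀ x : ℝ, macroDim (levelSet B x ω) ≤ 1 - H} = 1 := by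
  have hae : ∀ᵐ ω ∂P, ∀ a m : ℕ,
      ∑' k : ℕ, {k : ℕ | 1 ≤ k ∧ ∃ t ∈ Icc (0 : ℝ) 1, |B (k + t) ω| ≤ a}.indicator
        (fun k : ℕ => ENNReal.ofReal ((k : ℝ) ^ (-(1 - H + 1 / ((m : ℝ) + 1))))) k < ∞ := by
    refine ae_all_iff.2 fun a => ae_all_iff.2 fun m => ?_
    refine hB.ae_tsum_visit_lt_top hH.1 a.cast_nonneg ?_
    have : (0 : ℝ) < 1 / ((m : ℝ) + 1) := by positivity
    linarith
  refine le_antisymm prob_le_one ?_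
  rw [← measure_univ (μ := P)]
  refine measure_mono_ae ?_
  filter_upwards [hae] with ω hω _ x
  obtain ⟨a, ha⟩ := exists_nat_ge |x|
  refine le_of_forall_pos_le_add fun δ hδ => ?_
  obtain ⟨m, hm⟩ := exists_nat_one_div_lt hδ
  have hρ : 0 < 1 - H + 1 / ((m : ℝ) + 1) := by
    have : (0 : ℝ) < 1 / ((m : ℝ) + 1) := by positivity
    linarith [hH.2]
  have hbdd : BddBelow {ρ : ℝ | 0 < ρ ∧ (∑' n : ℕ, nu ρ n (levelSet B x ω)) ≠ ∞} :=
    ⟨0, fun ρ hρ => hρ.1.le⟩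
  suffices h : ∑' n : ℕ, nu (1 - H + 1 / ((m : ℝ) + 1)) n (levelSet B x ω) < ∞ from
    (csInf_le hbdd ⟨hρ, h.ne⟩).trans (by linarith)
  refine ((ENNReal.tsum_le_tsum fun n => nu_le_sum_indicator hρ.le n fun k hk hvisit => ?_).trans
    (tsum_sum_Ico_two_pow_le _)).trans_lt (hω a m)
  obtain ⟨t, ht, -, hBt⟩ := hvisit
  exact ⟨hk, t, ht, hBt ▸ ha⟩
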